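/- arXiv:2303.12288 — 2 statements merged into one kernel-verified Lean document; each statement's English description precedes it below -/
import Mathlib

section
/- The characteristic polynomial of s·I_{n+1} + c·F₁ equals (X − s)^{n+1}, and the characteristic polynomial of s·I_{n+1} + c·F₂ equals (X − s)^{n+1}. In particular det(s·I_{n+1} + c·F₁) = det(s·I_{n+1} + c·F₂) = s^{n+1}, so both matrices are invertible and all their eigenvalues equal the positive number s. -/
noncomputable section

open Matrix

/-- Block matrix `[[T, col, 0], [row, d, 0], [0, 0, e]]` of size `(n+1) × (n+1)`,
with blocks of sizes `n-1, 1, 1`. -/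
def blk (n : ℕ) (T : Fin (n-1) → Fin (n-1) → ℂ) (colv rowv : Fin (n-1) → ℂ)
    (d e : ℂ) : Matrix (Fin (n+1)) (Fin (n+1)) ℂ :=
  Matrix.of fun i j =>
    if hi : (i : ℕ) < n - 1 then
      if hj : (j : ℕ) < n - 1 then T ⟨i, hi⟩ ⟨j, hj⟩
      else if (j : ℕ) = n - 1 then colv ⟨i, hi⟩ else 0
    else if (i : ℕ) = n - 1 then
      if hj : (j : ℕ) < n - 1 then rowv ⟨j, hj⟩
      else if (j : ℕ) = n - 1 then d else 0
    else if (j : ℕ) = n then e else 0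

/-- The matrix `F₁ = [[(1/s)ξ♯ξᵀ, i ξ♯, 0], [i ξᵀ, −s, 0], [0, 0, 0]]`. -/
def F1mat (n : ℕ) (ξ ξs : Fin (n-1) → ℝ) (s : ℝ) :
    Matrix (Fin (n+1)) (Fin (n+1)) ℂ :=
  blk n (fun a b => ((1 / s * ξs a * ξ b : ℝ) : ℂ))
    (fun a => Complex.I * ((ξs a : ℝ) : ℂ))
    (fun b => Complex.I * ((ξ b : ℝ) : ℂ))
    ((-s : ℝ) : ℂ) 0

/-- The matrix `F₂ = [[(1/s)ξ♯ξᵀ, −i((λ+2μ)/μ) ξ♯, 0], [−i(μ/(λ+2μ)) ξᵀ, −s, 0], [0, 0, 0]]`. -/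
def F2mat (n : ℕ) (ξ ξs : Fin (n-1) → ℝ) (s lam mu : ℝ) :
    Matrix (Fin (n+1)) (Fin (n+1)) ℂ :=
  blk n (fun a b => ((1 / s * ξs a * ξ b : ℝ) : ℂ))
    (fun a => -(Complex.I * (((lam + 2*mu)/mu * ξs a : ℝ) : ℂ)))
    (fun b => -(Complex.I * ((mu/(lam + 2*mu) * ξ b : ℝ) : ℂ)))
    ((-s : ℝ) : ℂ) 0

/-- `b₁ = i(λ+μ)·[[0, (1/μ) ξ♯, 0], [(1/(λ+2μ)) ξᵀ, 0, 0], [0, 0, 0]]`. -/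
def b1mat (n : ℕ) (ξ ξs : Fin (n-1) → ℝ) (lam mu : ℝ) :
    Matrix (Fin (n+1)) (Fin (n+1)) ℂ :=
  (Complex.I * ((lam + mu : ℝ) : ℂ)) •
    blk n (fun _ _ => 0)
      (fun a => ((1/mu * ξs a : ℝ) : ℂ))
      (fun b => ((1/(lam + 2*mu) * ξ b : ℝ) : ℂ)) 0 0

/-- `c₂ = −[[s²·I + ((λ+μ)/μ) ξ♯ξᵀ, 0, 0], [0, (μ/(λ+2μ)) s², 0], [0, 0, s²]]`. -/
def c2mat (n : ℕ) (ξ ξs : Fin (n-1) → ℝ) (s lam mu : ℝ) :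
    Matrix (Fin (n+1)) (Fin (n+1)) ℂ :=
  -(blk n
      (fun a b => ((s^2 * (if a = b then 1 else 0) + (lam + mu)/mu * ξs a * ξ b : ℝ) : ℂ))
      (fun _ => 0) (fun _ => 0)
      ((mu/(lam + 2*mu) * s^2 : ℝ) : ℂ) ((s^2 : ℝ) : ℂ))

/-- The principal symbol `p₁` of the thermoelastic Dirichlet-to-Neumann map. -/
def p1mat (n : ℕ) (ξ ξs : Fin (n-1) → ℝ) (s lam mu al : ℝ) :
    Matrix (Fin (n+1)) (Fin (n+1)) ℂ :=
  blk n
    (fun a b => ((mu * s * (if a = b then 1 else 0)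
        + mu * (lam + mu)/((lam + 3*mu) * s) * ξs a * ξ b : ℝ) : ℂ))
    (fun a => -(Complex.I * ((2 * mu^2/(lam + 3*mu) * ξs a : ℝ) : ℂ)))
    (fun b => Complex.I * ((2 * mu^2/(lam + 3*mu) * ξ b : ℝ) : ℂ))
    ((2 * mu * (lam + 2*mu)/(lam + 3*mu) * s : ℝ) : ℂ)
    ((al * s : ℝ) : ℂ)

/-- `A = blockdiag(μ·I, λ+2μ, α)`. -/
def Amat (n : ℕ) (lam mu al : ℝ) : Matrix (Fin (n+1)) (Fin (n+1)) ℂ :=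
  blk n (fun a b => if a = b then ((mu : ℝ) : ℂ) else 0)
    (fun _ => 0) (fun _ => 0) ((lam + 2*mu : ℝ) : ℂ) ((al : ℝ) : ℂ)

/-- `d₁ = [[0, iμ ξ♯, 0], [iλ ξᵀ, 0, 0], [0, 0, 0]]`. -/
def d1mat (n : ℕ) (ξ ξs : Fin (n-1) → ℝ) (lam mu : ℝ) :
    Matrix (Fin (n+1)) (Fin (n+1)) ℂ :=
  blk n (fun _ _ => 0)
    (fun a => Complex.I * ((mu * ξs a : ℝ) : ℂ))
    (fun b => Complex.I * ((lam * ξ b : ℝ) : ℂ)) 0 0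

/-- `W = blockdiag(G⁻¹, 1, 1)`. -/
def Wmat (n : ℕ) (G : Matrix (Fin (n-1)) (Fin (n-1)) ℝ) :
    Matrix (Fin (n+1)) (Fin (n+1)) ℂ :=
  blk n (fun a b => ((G⁻¹ a b : ℝ) : ℂ)) (fun _ => 0) (fun _ => 0) 1 1

def extv (n : ℕ) (x : Fin (n-1) → ℂ) (k : ℂ) : Fin (n+1) → ℂ := fun i =>
  if h : (i : ℕ) < n - 1 then x ⟨i, h⟩ else if (i : ℕ) = n - 1 then k else 0

lemma extv_dot (n : ℕ) (hn : 2 ≤ n) (x y : Fin (n-1) → ℂ) (k w : ℂ) :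
    extv n x k ⬝ᵥ extv n y w = x ⬝ᵥ y + k * w := by
  obtain ⟨m, rfl⟩ : ∃ m, n = m + 1 := ⟨n - 1, by omega⟩
  simp only [dotProduct]
  rw [Fin.sum_univ_castSucc, Fin.sum_univ_castSucc]
  simp [extv]

lemma blk_eq (n : ℕ) (hn : 2 ≤ n) (T : Fin (n-1) → Fin (n-1) → ℂ)
    (colv rowv x y : Fin (n-1) → ℂ) (d k w : ℂ)
    (hT : ∀ a b, T a b = x a * y b) (hc : ∀ a, colv a = x a * w)
    (hr : ∀ b, rowv b = k * y b) (hd : d = k * w) :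
    blk n T colv rowv d 0 = vecMulVec (extv n x k) (extv n y w) := by
  ext i j
  simp only [blk, extv, vecMulVec_apply, Matrix.of_apply]
  split_ifs <;> simp [hT, hc, hr, hd]

lemma all_of (n : ℕ) (u v : Fin (n+1) → ℂ) (h : u ⬝ᵥ v = 0) (s c : ℂ) (hs : s ≠ 0)
    (F : Matrix (Fin (n+1)) (Fin (n+1)) ℂ) (hF : F = vecMulVec u v) :
    (s • (1 : Matrix (Fin (n+1)) (Fin (n+1)) ℂ) + c • F).charpoly
        = (Polynomial.X - Polynomial.C s) ^ (n+1)
    ∧ (s • (1 : Matrix (Fin (n+1)) (Fin (n+1)) ℂ) + c • F).det = s ^ (n+1)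
    ∧ IsUnit (s • (1 : Matrix (Fin (n+1)) (Fin (n+1)) ℂ) + c • F)
    ∧ ∀ z ∈ spectrum ℂ (s • (1 : Matrix (Fin (n+1)) (Fin (n+1)) ℂ) + c • F), z = s := by
  have h1 : (s • (1 : Matrix (Fin (n+1)) (Fin (n+1)) ℂ) + c • F).charpoly
        = (Polynomial.X - Polynomial.C s) ^ (n+1) := by
    have e : s • (1 : Matrix (Fin (n+1)) (Fin (n+1)) ℂ) + c • F
        = vecMulVec (c • u) v - scalar _ (-s) := by
      rw [hF, smul_vecMulVec, map_neg, sub_neg_eq_add, add_comm (s • _), scalar_apply,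
        smul_one_eq_diagonal]
    rw [e, charpoly_sub_scalar, charpoly_vecMulVec]
    simp [h, sub_eq_add_neg]
  have h2 : (s • (1 : Matrix (Fin (n+1)) (Fin (n+1)) ℂ) + c • F).det = s ^ (n+1) := by
    rw [det_eq_sign_charpoly_coeff, h1, Polynomial.coeff_zero_eq_eval_zero]
    simp [← mul_pow]
  refine ⟨h1, h2, ?_, ?_⟩
  · rw [isUnit_iff_isUnit_det, h2]
    exact (pow_ne_zero _ hs).isUnit
  · intro z hz
    rw [mem_spectrum_iff_isRoot_charpoly, h1] at hz
    simpa [sub_eq_zero] using hz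

/-- charpoly of s·I + c·F₁ and of s·I + c·F₂ is (X − s)^(n+1); in particular
both determinants equal s^(n+1), both matrices are invertible, and every eigenvalue equals s. -/
theorem stmt5 (n : ℕ) (hn : 2 ≤ n)
    (G : Matrix (Fin (n-1)) (Fin (n-1)) ℝ) (hG : G.PosDef)
    (ξ : Fin (n-1) → ℝ) (hξ : ξ ≠ 0)
    (ξs : Fin (n-1) → ℝ) (hξs : ξs = G.mulVec ξ)
    (s : ℝ) (hs : s = Real.sqrt (ξ ⬝ᵥ G.mulVec ξ))
    (lam mu : ℝ) (hmu : 0 < mu) (hlm : 0 ≤ lam + mu)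
    (c : ℝ) (hc : c = (lam + mu)/(lam + 3*mu)) :
    ((s : ℂ) • (1 : Matrix (Fin (n+1)) (Fin (n+1)) ℂ) + (c : ℂ) • F1mat n ξ ξs s).charpoly
        = (Polynomial.X - Polynomial.C (s : ℂ)) ^ (n+1)
    ∧ ((s : ℂ) • (1 : Matrix (Fin (n+1)) (Fin (n+1)) ℂ) + (c : ℂ) • F2mat n ξ ξs s lam mu).charpoly
        = (Polynomial.X - Polynomial.C (s : ℂ)) ^ (n+1)
    ∧ ((s : ℂ) • (1 : Matrix (Fin (n+1)) (Fin (n+1)) ℂ) + (c : ℂ) • F1mat n ξ ξs s).det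
        = (s : ℂ) ^ (n+1)
    ∧ ((s : ℂ) • (1 : Matrix (Fin (n+1)) (Fin (n+1)) ℂ) + (c : ℂ) • F2mat n ξ ξs s lam mu).det
        = (s : ℂ) ^ (n+1)
    ∧ IsUnit ((s : ℂ) • (1 : Matrix (Fin (n+1)) (Fin (n+1)) ℂ) + (c : ℂ) • F1mat n ξ ξs s)
    ∧ IsUnit ((s : ℂ) • (1 : Matrix (Fin (n+1)) (Fin (n+1)) ℂ) + (c : ℂ) • F2mat n ξ ξs s lam mu)
    ∧ (∀ z ∈ spectrum ℂ
        ((s : ℂ) • (1 : Matrix (Fin (n+1)) (Fin (n+1)) ℂ) + (c : ℂ) • F1mat n ξ ξs s),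
        z = (s : ℂ))
    ∧ (∀ z ∈ spectrum ℂ
        ((s : ℂ) • (1 : Matrix (Fin (n+1)) (Fin (n+1)) ℂ) + (c : ℂ) • F2mat n ξ ξs s lam mu),
        z = (s : ℂ))
    ∧ 0 < s := by
  have hpos : 0 < ξ ⬝ᵥ G.mulVec ξ := by
    simpa using hG.dotProduct_mulVec_pos hξ
  have hs0 : 0 < s := by rw [hs]; exact Real.sqrt_pos.2 hpos
  have hss : ξs ⬝ᵥ ξ = s * s := by
    rw [hs, Real.mul_self_sqrt hpos.le, hξs, dotProduct_comm]
  have hsc : (s : ℂ) ≠ 0 := by exact_mod_cast hs0.ne'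
  have hmc : (mu : ℂ) ≠ 0 := by exact_mod_cast hmu.ne'
  have hlc : (lam + 2 * mu : ℂ) ≠ 0 := by
    have : lam + 2 * mu ≠ 0 := by linarith
    exact_mod_cast this
  have hdot : (fun a => (ξs a : ℂ) / s) ⬝ᵥ (fun b => (ξ b : ℂ)) = s := by
    have h2 : ((ξs ⬝ᵥ ξ : ℝ) : ℂ) = s * s := by rw [hss]; push_cast; rfl
    simp only [dotProduct] at h2 ⊢
    push_cast at h2
    rw [Finset.sum_congr rfl (fun a _ => div_mul_eq_mul_div _ _ _), ← Finset.sum_div, h2]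
    field_simp
  obtain ⟨a1, a2, a3, a4⟩ := all_of n
    (extv n (fun a => (ξs a : ℂ) / s) Complex.I)
    (extv n (fun b => (ξ b : ℂ)) (Complex.I * s))
    (by rw [extv_dot n hn, hdot, ← mul_assoc, Complex.I_mul_I]; ring)
    s c hsc (F1mat n ξ ξs s)
    (blk_eq n hn _ _ _ _ _ _ _ _
      (fun a b => by push_cast; field_simp)
      (fun a => by field_simp)
      (fun b => rfl)
      (by rw [← mul_assoc, Complex.I_mul_I]; push_cast; ring))
  have hk : (-(Complex.I * (mu / (lam + 2 * mu)))) * (-(Complex.I * ((lam + 2 * mu) / mu) * s))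
      = -(s : ℂ) := by
    have : (mu / (lam + 2 * mu) : ℂ) * ((lam + 2 * mu) / mu) = 1 := by
      rw [div_mul_div_comm, mul_comm, div_self (mul_ne_zero hlc hmc)]
    linear_combination (Complex.I * Complex.I * s) * this + (s : ℂ) * Complex.I_mul_I
  obtain ⟨b1, b2, b3, b4⟩ := all_of n
    (extv n (fun a => (ξs a : ℂ) / s) (-(Complex.I * (mu / (lam + 2 * mu)))))
    (extv n (fun b => (ξ b : ℂ)) (-(Complex.I * ((lam + 2 * mu) / mu) * s)))
    (by rw [extv_dot n hn, hdot, hk]; ring)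
    s c hsc (F2mat n ξ ξs s lam mu)
    (blk_eq n hn _ _ _ _ _ _ _ _
      (fun a b => by push_cast; field_simp)
      (fun a => by push_cast; field_simp)
      (fun b => by push_cast; ring)
      (by rw [hk]; push_cast; ring))
  exact ⟨a1, b1, a2, b2, a3, b3, a4, b4, hs0⟩
end
end

section
/- With A := blockdiag(μ·I_{n−1}, λ+2μ, α) and d₁ := [[0, iμ ξ♯, 0], [iλ ξᵀ, 0, 0], [0, 0, 0]], one has A·(s·I_{n+1} + c·F₁) − d₁ = p₁, where p₁ := [[μs·I_{n−1} + (μ(λ+μ)/((λ+3μ)s))·ξ♯ξᵀ, −(2iμ²/(λ+3μ))·ξ♯, 0], [(2iμ²/(λ+3μ))·ξᵀ, (2μ(λ+2μ)/(λ+3μ))·s, 0], [0, 0, αs]]. -/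
noncomputable section

open Matrix

/-- A·(s·I + c·F₁) − d₁ = p₁ (formula (18) of Theorem 1.3). -/
theorem stmt9 (n : ℕ) (hn : 2 ≤ n)
    (G : Matrix (Fin (n-1)) (Fin (n-1)) ℝ) (hG : G.PosDef)
    (ξ : Fin (n-1) → ℝ) (hξ : ξ ≠ 0)
    (ξs : Fin (n-1) → ℝ) (hξs : ξs = G.mulVec ξ)
    (s : ℝ) (hs : s = Real.sqrt (ξ ⬝ᵥ G.mulVec ξ))
    (lam mu : ℝ) (hmu : 0 < mu) (hlm : 0 ≤ lam + mu)
    (c : ℝ) (hc : c = (lam + mu)/(lam + 3*mu)) (al : ℝ) (hal : 0 < al) :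
    Amat n lam mu al
        * ((s : ℂ) • (1 : Matrix (Fin (n+1)) (Fin (n+1)) ℂ) + (c : ℂ) • F1mat n ξ ξs s)
      - d1mat n ξ ξs lam mu
    = p1mat n ξ ξs s lam mu al := by
  have h3 : (lam : ℂ) + 3 * mu ≠ 0 := by
    have : lam + 3 * mu ≠ 0 := by linarith
    exact_mod_cast this
  have hA : Amat n lam mu al = Matrix.diagonal (fun i : Fin (n+1) =>
      if (i : ℕ) < n - 1 then (mu : ℂ) else if (i : ℕ) = n - 1 then (lam + 2 * mu : ℂ)
        else (al : ℂ)) := by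
    ext i j
    have hi := i.isLt
    have hj := j.isLt
    simp only [Amat, blk, Matrix.of_apply, Matrix.diagonal_apply, Fin.ext_iff]
    split_ifs <;> first | rfl | omega | (push_cast; rfl)
  have hc' : (c : ℂ) = (lam + mu) / (lam + 3 * mu) := by rw [hc]; push_cast; rfl
  rw [hA]
  ext i j
  have hi := i.isLt
  have hj := j.isLt
  rw [Matrix.sub_apply, Matrix.diagonal_mul, Matrix.add_apply, Matrix.smul_apply,
    Matrix.smul_apply, Matrix.one_apply, hc']
  simp only [F1mat, d1mat, p1mat, blk, Matrix.of_apply, Fin.ext_iff, smul_eq_mul]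
  split_ifs <;> first
    | omega
    | (push_cast; ring1)
    | (push_cast; simp only [div_eq_mul_inv, mul_inv]; ring1)
    | (push_cast
       generalize hD : (lam : ℂ) + 3 * mu = D at h3 ⊢
       have hl : (lam : ℂ) = D - 3 * mu := by rw [← hD]; ring
       rw [hl]
       field_simp
       ring1)
end
end
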